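/- Let A and B be unital C*-algebras, ψ : A → B a continuous linear completely positive map, H a group, and u : H → A a group homomorphism into the unitary group of A (u(1) = 1, u(g h) = u(g) * u(h), and star(u(g)) * u(g) = u(g) * star(u(g)) = 1). Suppose there is a self-adjoint idempotent p ∈ B with star(ψ 1) * ψ 1 = p and (ψ 1) * star(ψ 1) = p. Then: ψ 1 = p; the set H_p = {h ∈ H | star(ψ(u h)) * ψ(u h) = p and ψ(u h) * star(ψ(u h)) = p} is a subgroup of H; ψ(u(h k)) = ψ(u h) * ψ(u k) and ψ(u(k h)) = ψ(u k) * ψ(u h) for all h ∈ H and k ∈ H_p; ψ(u(h⁻¹)) = star(ψ(u h)) for all h ∈ H; and p * ψ(u h) * p = ψ(u h) for all h ∈ H. In particular h ↦ ψ(u h) restricts to a group homomorphism from H_p into the group D_p. -/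

import Mathlib

/-- For `p` a self-adjoint idempotent, `Dset p = {x | star x * x = p ∧ x * star x = p}`. -/
def Dset {B : Type*} [Mul B] [Star B] (p : B) : Set B :=
  {x | star x * x = p ∧ x * star x = p}

/-- A continuous linear map `ψ : A → B` between unital C*-algebras is completely positive
if `0 ≤ ∑ᵢ ∑ⱼ star (b i) * ψ (star (a i) * a j) * (b j)` for all finite tuples. -/
def CompletelyPositive {A B : Type*}
    [NormedRing A] [StarRing A] [NormedAlgebra ℂ A]
    [NormedRing B] [StarRing B] [NormedAlgebra ℂ B] [PartialOrder B]
    (ψ : A →L[ℂ] B) : Prop :=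
  ∀ (n : ℕ) (a : Fin n → A) (b : Fin n → B),
    0 ≤ ∑ i : Fin n, ∑ j : Fin n, star (b i) * ψ (star (a i) * a j) * b j

section

variable {B : Type*} [NormedRing B] [StarRing B] [PartialOrder B] [StarOrderedRing B]

theorem eq_zero_of_neg_star_mul_self_nonneg [CStarRing B] {d : B}
    (hd : 0 ≤ -(star d * d)) : d = 0 :=
  CStarRing.star_mul_self_eq_zero_iff d |>.mp
    (le_antisymm (neg_nonneg.mp hd) (star_mul_self_nonneg d))

/-- A nonnegative square root of a projection is that projection. -/
theorem eq_of_nonneg_of_mul_self_eq_projection [CStarRing B] {e p : B} (he : 0 ≤ e)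
    (hee : e * e = p) (hpsa : star p = p) (hpi : p * p = p) : e = p := by
  have hesa : star e = e := (IsSelfAdjoint.of_nonneg he).star_eq
  have hep : e * p = e := by
    refine sub_eq_zero.mp (CStarRing.star_mul_self_eq_zero_iff (e * p - e) |>.mp ?_)
    calc star (e * p - e) * (e * p - e)
        = p * (e * e) * p - p * (e * e) - (e * e) * p + e * e := by
          rw [star_sub, star_mul, hesa, hpsa]; noncomm_ring
      _ = 0 := by rw [hee, hpi, hpi]; abel
  have hqeq : star (p - e) * e * (p - e) = -(star (p - e) * (p - e)) := by
    have heq : e * (p - e) = -(p - e) := by rw [mul_sub, hep, hee]; abel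
    rw [mul_assoc, heq, mul_neg]
  exact (sub_eq_zero.mp (eq_zero_of_neg_star_mul_self_nonneg
    (hqeq ▸ star_left_conjugate_nonneg he (p - e)))).symm

end

namespace CompletelyPositive

variable {A B : Type*} [NormedRing A] [StarRing A] [NormedAlgebra ℂ A]
  [NormedRing B] [StarRing B] [NormedAlgebra ℂ B] [PartialOrder B]
  {ψ : A →L[ℂ] B}

theorem map_star_mul_self_nonneg (hψ : CompletelyPositive ψ) (a : A) :
    0 ≤ ψ (star a * a) := by
  simpa using hψ 1 ![a] ![1]

variable [StarOrderedRing B]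

theorem map_star [StarModule ℂ B] (hψ : CompletelyPositive ψ) (a : A) :
    ψ (star a) = star (ψ a) := by
  have hone : star (ψ 1) = ψ 1 := by
    simpa using (IsSelfAdjoint.of_nonneg (hψ.map_star_mul_self_nonneg 1)).star_eq
  have haa := (IsSelfAdjoint.of_nonneg (hψ.map_star_mul_self_nonneg a)).star_eq
  have hsum := (IsSelfAdjoint.of_nonneg (hψ 2 ![1, a] ![1, 1])).star_eq
  have hdiff := (IsSelfAdjoint.of_nonneg (hψ 2 ![1, a] ![1, Complex.I • 1])).star_eq
  simp [Fin.sum_univ_two, hone, haa, smul_smul] at hsum hdiff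
  have hdiff' : star (ψ a) + ψ a = star (ψ (star a)) + ψ (star a) := by
    refine (smul_right_inj Complex.I_ne_zero).mp ?_
    simp only [smul_add]
    linear_combination (norm := module) -hdiff
  refine (smul_right_inj (two_ne_zero (α := ℂ))).mp ?_
  simp only [two_smul]
  linear_combination (norm := module) -hsum - hdiff'

variable [CStarRing B] {p : B}

/-- If `ψ 1` is a projection, it is a left unit for the image of every isometry. -/
theorem projection_mul_map [StarModule ℂ B] (hψ : CompletelyPositive ψ) (hp : ψ 1 = p)
    (hpsa : star p = p) (hpi : p * p = p) {a : A} (ha : star a * a = 1) :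
    p * ψ a = ψ a := by
  have key := hψ 2 ![1, a] ![1 - p, -(star (ψ a) * (1 - p))]
  have hconj := star_mul_self_nonneg ((1 - p) * star (ψ a) * (1 - p))
  have h0 : star (ψ a) * (1 - p) = 0 := by
    apply eq_zero_of_neg_star_mul_self_nonneg
    refine (add_nonneg key hconj).trans_eq ?_
    have hq : (1 - p) * (1 - p) = 1 - p := by simp [mul_sub, sub_mul, hpi]
    have hpq : p * (1 - p) = 0 := by simp [mul_sub, hpi]
    have hqq (y : B) : (1 - p) * ((1 - p) * y) = (1 - p) * y := by rw [← mul_assoc, hq]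
    simp [Fin.sum_univ_two, ha, hp, hpsa, hψ.map_star, mul_assoc, hpq, hqq]
    noncomm_ring
  have h1 := congrArg star h0
  simp only [star_mul, star_sub, star_one, hpsa, star_star, star_zero, sub_mul, one_mul] at h1
  exact (sub_eq_zero.mp h1).symm

/-- If `ψ 1` is a projection, then `ψ (a * b) = ψ a * ψ b` for every unitary `a` and every
isometry `b` such that `star (ψ b) * ψ b = ψ 1`. -/
theorem map_mul_of_star_mul_self_eq [StarModule ℂ B] (hψ : CompletelyPositive ψ) (hp : ψ 1 = p)
    (hpsa : star p = p) (hpi : p * p = p) {a b : A} (ha : a * star a = 1)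
    (ha' : star a * a = 1) (hb : star b * b = 1)
    (hv : star (ψ b) * ψ b = p) : ψ (a * b) = ψ a * ψ b := by
  have hpa := hψ.projection_mul_map hp hpsa hpi ha'
  have hpb := hψ.projection_mul_map hp hpsa hpi hb
  have hab : star (a * b) * (a * b) = 1 := by
    rw [star_mul, mul_assoc, ← mul_assoc (star a), ha', one_mul, hb]
  have hpab := hψ.projection_mul_map hp hpsa hpi hab
  set d := ψ (a * b) - ψ a * ψ b with hd
  have hpd : p * d = d := by rw [hd, mul_sub, hpab, ← mul_assoc, hpa]
  have key := hψ 3 ![star a, b, 1] ![-d, 1, -ψ b]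
  refine sub_eq_zero.mp (eq_zero_of_neg_star_mul_self_nonneg (d := d) (key.trans_eq ?_))
  have hsba : ψ (star b * star a) = star (ψ (a * b)) := by rw [← star_mul, hψ.map_star]
  simp [Fin.sum_univ_three, ha, hb, hp, hψ.map_star, hsba, hpd, hpsa, hpb, hv, mul_assoc]
  rw [show ψ (a * b) = d + ψ a * ψ b by rw [hd]; abel, star_add, star_mul]
  noncomm_ring

end CompletelyPositive

/-- If `ψ` is completely positive, `u : H → A` a unitary representation, and
`star (ψ 1) * ψ 1 = (ψ 1) * star (ψ 1) = p` for a self-adjoint idempotent `p`, then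
`ψ 1 = p`, `H_p` is a subgroup of `H`, `h ↦ ψ (u h)` is multiplicative against `H_p`,
star-preserving, and maps into `p * B * p`. -/
theorem stmt14 {A B : Type*}
    [NormedRing A] [StarRing A] [CStarRing A] [CompleteSpace A]
    [NormedAlgebra ℂ A] [StarModule ℂ A]
    [NormedRing B] [StarRing B] [CStarRing B] [CompleteSpace B]
    [NormedAlgebra ℂ B] [StarModule ℂ B] [PartialOrder B] [StarOrderedRing B]
    {H : Type*} [Group H]
    (ψ : A →L[ℂ] B) (hψ : CompletelyPositive ψ)
    (u : H → A) (hu1 : u 1 = 1) (humul : ∀ g h : H, u (g * h) = u g * u h)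
    (huni : ∀ g : H, star (u g) * u g = 1 ∧ u g * star (u g) = 1)
    (p : B) (hpsa : star p = p) (hpi : p * p = p)
    (hp1 : star (ψ 1) * ψ 1 = p ∧ ψ 1 * star (ψ 1) = p)
    (Hp : Set H)
    (hHp : Hp = {h : H | star (ψ (u h)) * ψ (u h) = p ∧
      ψ (u h) * star (ψ (u h)) = p}) :
    ψ 1 = p ∧
    ((1 : H) ∈ Hp ∧ (∀ h ∈ Hp, ∀ k ∈ Hp, h * k ∈ Hp) ∧ (∀ h ∈ Hp, h⁻¹ ∈ Hp)) ∧
    (∀ h : H, ∀ k ∈ Hp, ψ (u (h * k)) = ψ (u h) * ψ (u k) ∧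
      ψ (u (k * h)) = ψ (u k) * ψ (u h)) ∧
    (∀ h : H, ψ (u h⁻¹) = star (ψ (u h))) ∧
    (∀ h : H, p * ψ (u h) * p = ψ (u h)) ∧
    (∀ k ∈ Hp, ψ (u k) ∈ Dset p) := by
  have hpos : 0 ≤ ψ 1 := by simpa using hψ.map_star_mul_self_nonneg 1
  have hp : ψ 1 = p := by
    refine eq_of_nonneg_of_mul_self_eq_projection hpos ?_ hpsa hpi
    rw [← hp1.1, (IsSelfAdjoint.of_nonneg hpos).star_eq]
  have hinv (h : H) : u h⁻¹ = star (u h) :=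
    left_inv_eq_right_inv (by rw [← humul, inv_mul_cancel, hu1]) (huni h).2
  have hstar (h : H) : ψ (u h⁻¹) = star (ψ (u h)) := by rw [hinv, hψ.map_star]
  have hleft (h : H) : p * ψ (u h) = ψ (u h) :=
    hψ.projection_mul_map hp hpsa hpi (huni h).1
  have hright (h : H) : ψ (u h) * p = ψ (u h) := by
    simpa [hstar, hpsa] using congrArg star (hleft h⁻¹)
  have hmul (h k : H) (hk : star (ψ (u k)) * ψ (u k) = p) :
      ψ (u (h * k)) = ψ (u h) * ψ (u k) := by
    rw [humul]
    exact hψ.map_mul_of_star_mul_self_eq hp hpsa hpi (huni h).2 (huni h).1 (huni k).1 hk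
  subst hHp
  refine ⟨hp, ⟨?_, ?_, ?_⟩, ?_, hstar, fun h => by rw [hleft, hright], fun k hk => hk⟩
  · simpa [hu1] using hp1
  · rintro h ⟨hh, hh'⟩ k ⟨hk, hk'⟩
    rw [Set.mem_ofPred_eq, hmul h k hk, star_mul]
    constructor
    · rw [mul_assoc, ← mul_assoc _ (ψ (u h)), hh, hleft, hk]
    · rw [mul_assoc, ← mul_assoc (ψ (u k)), hk', ← mul_assoc, hright, hh']
  · rintro h ⟨hh, hh'⟩
    simpa [hstar] using And.intro hh' hh
  · rintro h k ⟨hk, hk'⟩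
    refine ⟨hmul h k hk, ?_⟩
    have := hmul h⁻¹ k⁻¹ (by rwa [hstar, star_star])
    rw [← mul_inv_rev, hstar, hstar, hstar, ← star_mul] at this
    exact star_injective this
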